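/- arXiv:1602.07313 — 4 statements merged into one kernel-verified Lean document; each statement's English description precedes it below -/
import Mathlib

section
/- Let α > −1 and n ∈ ℕ₀. For all x, t with x + t ≠ 1: (x + t − 1)^n φ_n^{(α)}(xt/(x+t−1)) = (α+1)_n · Σ_{k=0}^n p_{n,k}(x) p_{n,k}(t) / (C(n,k) (α+1)_k (α+1)_{n−k}). -/
noncomputable section

open Set Finset
open scoped Classical

/-- The interval `[0,1]`. -/
def I01 : Set ℝ := Set.Icc 0 1

/-- The Bernstein fundamental polynomials `p_{n,k}(x) = C(n,k) x^k (1-x)^{n-k}`. -/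
def bern (n k : ℕ) (x : ℝ) : ℝ := (n.choose k : ℝ) * x ^ k * (1 - x) ^ (n - k)

/-- The Pochhammer symbol `(x)_k = x(x+1)⋯(x+k-1)`. -/
def poch (x : ℝ) (k : ℕ) : ℝ := (ascPochhammer ℝ k).eval x

/-- The shifted ultraspherical polynomial on `[0,1]`, normalized so that `φ_n^{(α)}(1) = 1`,
given on `(0,1)` by the Rodrigues-type formula
`φ_n^{(α)}(x) = ((-1)^n/(α+1)_n) x^{-α}(1-x)^{-α} (d^n/dx^n)[x^{n+α}(1-x)^{n+α}]`. -/
def ultra (α : ℝ) (n : ℕ) (x : ℝ) : ℝ :=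
  (-1 : ℝ) ^ n / poch (α + 1) n * x ^ (-α) * (1 - x) ^ (-α) *
    iteratedDeriv n (fun y : ℝ => y ^ ((n : ℝ) + α) * (1 - y) ^ ((n : ℝ) + α)) x

open Polynomial in
lemma descPochhammer_eval_mul_poch (α : ℝ) (m k : ℕ) :
    (descPochhammer ℝ k).eval ((m : ℝ) + k + α) * poch (α + 1) m = poch (α + 1) (m + k) := by
  unfold poch
  rw [descPochhammer_eval_eq_ascPochhammer, ← ascPochhammer_mul, eval_mul, eval_comp, mul_comm]
  congr 2
  simp only [eval_add, eval_X, eval_natCast]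
  ring

lemma poch_pos {β : ℝ} (hβ : 0 < β) (k : ℕ) : 0 < poch β k :=
  ascPochhammer_pos k β hβ

/-- Leibniz expansion of the Rodrigues formula. -/
lemma ultra_eq_sum {α : ℝ} (hα : -1 < α) (n : ℕ) {x : ℝ} (hx : x ∈ Set.Ioo (0 : ℝ) 1) :
    ultra α n x = poch (α + 1) n * ∑ k ∈ Finset.range (n + 1),
      (n.choose k : ℝ) * (-1) ^ (n - k) * x ^ k * (1 - x) ^ (n - k) /
        (poch (α + 1) k * poch (α + 1) (n - k)) := by
  have h0 : 0 < x := hx.1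
  have h1 : 0 < 1 - x := sub_pos.2 hx.2
  have hP : ∀ k, poch (α + 1) k ≠ 0 := fun k => (poch_pos (by linarith) k).ne'
  have hf : ContDiffAt ℝ n (fun y : ℝ => y ^ ((n : ℝ) + α)) x :=
    Real.contDiffAt_rpow_const_of_ne h0.ne'
  have hg : ContDiffAt ℝ n (fun y : ℝ => (1 - y) ^ ((n : ℝ) + α)) x :=
    (contDiffAt_const.sub contDiffAt_id).rpow_const_of_ne h1.ne'
  have hmul : (fun y : ℝ => y ^ ((n : ℝ) + α) * (1 - y) ^ ((n : ℝ) + α)) =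
      (fun y : ℝ => (1 - y) ^ ((n : ℝ) + α)) * (fun y : ℝ => y ^ ((n : ℝ) + α)) := by
    ext y
    exact mul_comm _ _
  have hd : ∀ (k : ℕ) (z : ℝ), iteratedDeriv k (fun y : ℝ => y ^ ((n : ℝ) + α)) z =
      (descPochhammer ℝ k).eval ((n : ℝ) + α) * z ^ ((n : ℝ) + α - k) := fun k z => by
    rw [iteratedDeriv_eq_iterate, Real.iter_deriv_rpow_const]
  unfold ultra
  rw [hmul, iteratedDeriv_mul hg hf, Finset.mul_sum, Finset.mul_sum]
  refine Finset.sum_congr rfl fun k hk => ?_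
  obtain ⟨m, rfl⟩ := Nat.exists_eq_add_of_le (Nat.lt_succ_iff.1 (Finset.mem_range.1 hk))
  have hc := congrFun (iteratedDeriv_comp_const_sub k
    (fun y : ℝ => y ^ (((k + m : ℕ) : ℝ) + α)) 1) x
  rw [hc, hd, hd, Nat.add_sub_cancel_left]
  have e1 := descPochhammer_eval_mul_poch α m k
  have e2 := descPochhammer_eval_mul_poch α k m
  rw [add_comm m k, add_comm (m : ℝ)] at e1
  have r1 : (1 - x) ^ (((k + m : ℕ) : ℝ) + α - k) = (1 - x) ^ m * (1 - x) ^ α := by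
    rw [← Real.rpow_natCast, ← Real.rpow_add h1]
    congr 1
    push_cast
    ring
  have r2 : x ^ (((k + m : ℕ) : ℝ) + α - m) = x ^ k * x ^ α := by
    rw [← Real.rpow_natCast, ← Real.rpow_add h0]
    congr 1
    push_cast
    ring
  have hs : (-1 : ℝ) ^ k * (-1) ^ k = 1 := by rw [← mul_pow]; simp
  rw [r1, r2, Real.rpow_neg h0.le, Real.rpow_neg h1.le]
  push_cast
  rw [eq_div_of_mul_eq (hP _) e1, eq_div_of_mul_eq (hP _) e2, pow_add, smul_eq_mul]
  have a0 := (Real.rpow_pos_of_pos h0 α).ne'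
  have a1 := (Real.rpow_pos_of_pos h1 α).ne'
  have p1 := hP k
  have p2 := hP m
  have p3 := hP (k + m)
  field_simp
  linear_combination ((k + m).choose k : ℝ) * hs

open Polynomial in
/-- A polynomial agreeing with `ultra` on `(0,1)` is given everywhere by the Leibniz expansion. -/
lemma eval_eq_sum_of_eq_ultra {α : ℝ} (hα : -1 < α) (n : ℕ) (p : ℝ[X])
    (hp : ∀ x ∈ Set.Ioo (0 : ℝ) 1, p.eval x = ultra α n x) (y : ℝ) :
    p.eval y = poch (α + 1) n * ∑ k ∈ Finset.range (n + 1),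
      (n.choose k : ℝ) * (-1) ^ (n - k) * y ^ k * (1 - y) ^ (n - k) /
        (poch (α + 1) k * poch (α + 1) (n - k)) := by
  let q : ℝ[X] := C (poch (α + 1) n) * ∑ k ∈ Finset.range (n + 1),
    C ((n.choose k : ℝ) * (-1) ^ (n - k) / (poch (α + 1) k * poch (α + 1) (n - k))) *
      X ^ k * (1 - X) ^ (n - k)
  have hq : ∀ z, q.eval z = poch (α + 1) n * ∑ k ∈ Finset.range (n + 1),
      (n.choose k : ℝ) * (-1) ^ (n - k) * z ^ k * (1 - z) ^ (n - k) /
        (poch (α + 1) k * poch (α + 1) (n - k)) := fun z => by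
    simp only [q, eval_mul, eval_C, eval_finsetSum, eval_pow, eval_X, eval_sub, eval_one]
    congr 1
    exact Finset.sum_congr rfl fun k _ => by ring
  rw [← hq]
  congr 1
  refine eq_of_infinite_eval_eq p q ((Set.Ioo_infinite one_pos).mono fun x hx => ?_)
  rw [Set.mem_ofPred_eq, hp x hx, hq, ultra_eq_sum hα n hx]

theorem statement15 (α : ℝ) (hα : -1 < α) (n : ℕ) (Φ : ℝ → ℝ)
    (hpoly : ∃ p : Polynomial ℝ, p.natDegree ≤ n ∧ ∀ x, Φ x = p.eval x)
    (hagree : ∀ x ∈ Set.Ioo (0 : ℝ) 1, Φ x = ultra α n x) :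
    ∀ x t : ℝ, x + t ≠ 1 →
      (x + t - 1) ^ n * Φ (x * t / (x + t - 1)) =
        poch (α + 1) n * ∑ k ∈ Finset.range (n + 1),
          bern n k x * bern n k t /
            ((n.choose k : ℝ) * poch (α + 1) k * poch (α + 1) (n - k)) := by
  intro x t hxt
  obtain ⟨p, -, hp⟩ := hpoly
  have hs : x + t - 1 ≠ 0 := sub_ne_zero.2 hxt
  rw [hp, eval_eq_sum_of_eq_ultra hα n p (fun z hz => by rw [← hp, hagree z hz]),
    mul_left_comm, Finset.mul_sum]
  congr 1
  refine Finset.sum_congr rfl fun k hk => ?_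
  have hkn : k ≤ n := Nat.lt_succ_iff.1 (Finset.mem_range.1 hk)
  have hC : (n.choose k : ℝ) ≠ 0 := Nat.cast_ne_zero.2 (Nat.choose_pos hkn).ne'
  have p1 := (poch_pos (by linarith : 0 < α + 1) k).ne'
  have p2 := (poch_pos (by linarith : 0 < α + 1) (n - k)).ne'
  have e1 : (x + t - 1) ^ k * (x * t / (x + t - 1)) ^ k = x ^ k * t ^ k := by
    rw [← mul_pow, mul_div_cancel₀ _ hs, mul_pow]
  have e2 : (x + t - 1) ^ (n - k) * ((-1) ^ (n - k) * (1 - x * t / (x + t - 1)) ^ (n - k)) =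
      (1 - x) ^ (n - k) * (1 - t) ^ (n - k) := by
    rw [← mul_pow, ← mul_pow, ← mul_pow]
    congr 1
    field_simp
    ring
  have e3 : (x + t - 1) ^ n = (x + t - 1) ^ k * (x + t - 1) ^ (n - k) := by
    rw [← pow_add, Nat.add_sub_cancel' hkn]
  unfold bern
  calc _ = (n.choose k : ℝ) * ((x + t - 1) ^ k * (x * t / (x + t - 1)) ^ k) *
        ((x + t - 1) ^ (n - k) * ((-1) ^ (n - k) * (1 - x * t / (x + t - 1)) ^ (n - k))) /
        (poch (α + 1) k * poch (α + 1) (n - k)) := by rw [e3]; ring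
    _ = _ := by
      rw [e1, e2]
      field_simp
end
end

section
/- Let α > −1/2, n ∈ ℕ₀, f ∈ C[0,1] and x ∈ [0,1]. Then the Bernstein–Durrmeyer–Lupaş operator admits the representation D_n^{⟨α⟩}(f,x) = ((2α+2)_n / (α+1)_n) · ∫₀¹ f(t) (∫₀¹ Θ(x,t,u)^n dw(u, α−1/2)) dw(t, α), where Θ(x,t,u) := (1−u) a(x,t) + u b(x,t) with a(x,t) := (√(xt) − √((1−x)(1−t)))² and b(x,t) := (√(xt) + √((1−x)(1−t)))². -/
noncomputable section

open Set Finset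
open scoped Classical

/-- The Beta function `B(x,y) = ∫₀¹ t^{x-1}(1-t)^{y-1} dt`. -/
def betaFn (x y : ℝ) : ℝ := ∫ t in (0 : ℝ)..1, t ^ (x - 1) * (1 - t) ^ (y - 1)

/-- The density of the ultraspherical weight `dw(t,α)` on `[0,1]`. -/
def wght (α t : ℝ) : ℝ := t ^ α * (1 - t) ^ α / betaFn (α + 1) (α + 1)

/-- The inner product `⟨f,g⟩ = ∫₀¹ f g dw(·,α)`. -/
def ip (α : ℝ) (f g : ℝ → ℝ) : ℝ := ∫ t in (0 : ℝ)..1, f t * g t * wght α t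

/-- The Bernstein–Durrmeyer–Lupaş operator with ultraspherical weight:
`D_n^{⟨α⟩}(f,x) = Σ_k p_{n,k}(x) ⟨p_{n,k}, f⟩ / ⟨p_{n,k}, 1⟩`. -/
def Dlup (α : ℝ) (n : ℕ) (f : ℝ → ℝ) (x : ℝ) : ℝ :=
  ∑ k ∈ Finset.range (n + 1),
    bern n k x * (ip α (bern n k) f / ip α (bern n k) (fun _ => 1))

/-- `a(x,t) = (√(xt) - √((1-x)(1-t)))²`. -/
def aFn (x t : ℝ) : ℝ := (Real.sqrt (x * t) - Real.sqrt ((1 - x) * (1 - t))) ^ 2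

/-- `b(x,t) = (√(xt) + √((1-x)(1-t)))²`. -/
def bFn (x t : ℝ) : ℝ := (Real.sqrt (x * t) + Real.sqrt ((1 - x) * (1 - t))) ^ 2

/-- `Θ(x,t,u) = (1-u) a(x,t) + u b(x,t)`. -/
def thetaFn (x t u : ℝ) : ℝ := (1 - u) * aFn x t + u * bFn x t

open MeasureTheory ProbabilityTheory

lemma poch_pos_s16 {c : ℝ} (hc : 0 < c) (k : ℕ) : 0 < poch c k := ascPochhammer_pos k c hc

lemma poch_zero (c : ℝ) : poch c 0 = 1 := by simp [poch]

lemma poch_succ (c : ℝ) (k : ℕ) : poch c (k + 1) = poch c k * (c + k) := by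
  simp [poch, ascPochhammer_succ_eval]

lemma poch_add (c : ℝ) (k l : ℕ) : poch c (k + l) = poch c k * poch (c + k) l := by
  simp [poch, ← ascPochhammer_mul]

lemma Gamma_add_nat {c : ℝ} (hc : 0 < c) (k : ℕ) :
    Real.Gamma (c + k) = poch c k * Real.Gamma c := by
  induction k with
  | zero => simp [poch_zero]
  | succ k ih =>
    rw [poch_succ, Nat.cast_succ, ← add_assoc, Real.Gamma_add_one (by positivity), ih]
    ring

lemma ofReal_beta_integrand {x y t : ℝ} (ht : t ∈ Set.uIoc (0 : ℝ) 1) :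
    (t : ℂ) ^ ((x : ℂ) - 1) * (1 - (t : ℂ)) ^ ((y : ℂ) - 1) =
      ((t ^ (x - 1) * (1 - t) ^ (y - 1) : ℝ) : ℂ) := by
  rw [Set.uIoc_of_le zero_le_one] at ht
  rw [Complex.ofReal_mul, Complex.ofReal_cpow ht.1.le, Complex.ofReal_cpow (sub_nonneg.2 ht.2)]
  push_cast
  rfl

lemma intervalIntegrable_beta_integrand {x y : ℝ} (hx : 0 < x) (hy : 0 < y) :
    IntervalIntegrable (fun t : ℝ => t ^ (x - 1) * (1 - t) ^ (y - 1)) volume 0 1 := by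
  have h := Complex.betaIntegral_convergent (u := x) (v := y) (by simpa) (by simpa)
  rw [intervalIntegrable_iff] at h ⊢
  refine IntegrableOn.congr_fun h.re (fun t ht => ?_) measurableSet_uIoc
  rw [ofReal_beta_integrand ht]
  exact Complex.ofReal_re _

lemma betaFn_eq_beta {x y : ℝ} (hx : 0 < x) (hy : 0 < y) : betaFn x y = beta x y := by
  rw [beta_eq_betaIntegralReal x y hx hy, Complex.betaIntegral, betaFn,
    intervalIntegral.integral_congr_ae (ae_of_all _ fun t ht => ofReal_beta_integrand ht),
    intervalIntegral.integral_ofReal, Complex.ofReal_re]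

lemma betaFn_pos {x y : ℝ} (hx : 0 < x) (hy : 0 < y) : 0 < betaFn x y :=
  betaFn_eq_beta hx hy ▸ beta_pos hx hy

lemma betaFn_add_nat {x y : ℝ} (hx : 0 < x) (hy : 0 < y) (k l : ℕ) :
    betaFn (x + k) (y + l) = poch x k * poch y l / poch (x + y) (k + l) * betaFn x y := by
  have h : x + k + (y + l) = x + y + (k + l : ℕ) := by push_cast; ring
  rw [betaFn_eq_beta (by positivity) (by positivity), betaFn_eq_beta hx hy, beta, beta, h,
    Gamma_add_nat hx, Gamma_add_nat hy, Gamma_add_nat (add_pos hx hy)]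
  have := (poch_pos_s16 (add_pos hx hy) (k + l)).ne'
  have := (Real.Gamma_pos_of_pos (add_pos hx hy)).ne'
  field_simp

lemma intervalIntegrable_wght {α : ℝ} (hα : -1 < α) :
    IntervalIntegrable (wght α) volume 0 1 := by
  have h := (intervalIntegrable_beta_integrand (x := α + 1) (y := α + 1) (by linarith)
    (by linarith)).div_const (betaFn (α + 1) (α + 1))
  simp only [add_sub_cancel_right] at h
  exact h

lemma ip_bern_one {α : ℝ} (hα : -1 < α) {n k : ℕ} (hk : k ≤ n) :
    ip α (bern n k) (fun _ => 1) =
      n.choose k * (poch (α + 1) k * poch (α + 1) (n - k)) / poch (2 * α + 2) n := by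
  have h1 : 0 < α + 1 := by linarith
  have hB := (betaFn_pos h1 h1).ne'
  have key : ip α (bern n k) (fun _ => 1) = n.choose k / betaFn (α + 1) (α + 1) *
      betaFn (α + 1 + k) (α + 1 + (n - k : ℕ)) := by
    rw [ip, betaFn.eq_def (α + 1 + k), ← intervalIntegral.integral_const_mul]
    simp only [intervalIntegral.integral_of_le zero_le_one, integral_Ioc_eq_integral_Ioo]
    refine setIntegral_congr_fun measurableSet_Ioo fun t ht => ?_
    have h3 : α + 1 + (k : ℝ) - 1 = α + k := by ring
    have h4 : α + 1 + ((n - k : ℕ) : ℝ) - 1 = α + (n - k : ℕ) := by ring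
    simp only [bern, wght, h3, h4, Real.rpow_add_natCast ht.1.ne',
      Real.rpow_add_natCast (sub_pos.2 ht.2).ne']
    ring
  have h2 : α + 1 + (α + 1) = 2 * α + 2 := by ring
  rw [key, betaFn_add_nat h1 h1, h2, Nat.add_sub_cancel' hk]
  field_simp

lemma poch_add_eq_sum (c : ℝ) (k j : ℕ) :
    poch (c + k) j =
      ∑ i ∈ range (j + 1), j.choose i * (k.descFactorial i * poch (c + i) (j - i)) := by
  have h := Ring.descPochhammer_smeval_add (r := (k : ℝ)) (s := c + j - 1) j (Commute.all _ _)
  have hd : ∀ (r : ℝ) (i : ℕ), Polynomial.aeval r (descPochhammer ℤ i) =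
      (descPochhammer ℝ i).eval r := fun r i => by
    rw [← descPochhammer_map (algebraMap ℤ ℝ), Polynomial.eval_map_algebraMap]
  simp only [← Polynomial.aeval_eq_smeval, Finset.Nat.sum_antidiagonal_eq_sum_range_succ_mk, hd,
    descPochhammer_eval_eq_descFactorial] at h
  rw [descPochhammer_eval_eq_ascPochhammer] at h
  have e : (k : ℝ) + (c + j - 1) - j + 1 = c + k := by ring
  rw [poch, ← e, h]
  refine Finset.sum_congr rfl fun i hi => ?_
  have hij : i ≤ j := by simp at hi; omega
  have e' : c + j - 1 - (j - i : ℕ) + 1 = c + i := by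
    push_cast [hij]
    ring
  rw [descPochhammer_eval_eq_ascPochhammer, e', poch]

lemma sum_inv_factorial_mul_poch {c : ℝ} (hc : 0 < c) (k j : ℕ) :
    ∑ m ∈ range (min k j + 1),
        1 / ((m.factorial : ℝ) * (k - m).factorial * (j - m).factorial * poch c m) =
      poch c (k + j) / (k.factorial * j.factorial * poch c k * poch c j) := by
  have hk := (poch_pos_s16 hc k).ne'
  have hj := (poch_pos_s16 hc j).ne'
  rw [poch_add, poch_add_eq_sum,
    ← Finset.sum_subset (Finset.range_subset_range.2 (by omega : min k j + 1 ≤ j + 1)), mul_sum,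
    Finset.sum_div]
  · refine Finset.sum_congr rfl fun m hm => ?_
    have hmk : m ≤ k := by simp at hm; omega
    have hmj : m ≤ j := by simp at hm; omega
    have hm := (poch_pos_s16 hc m).ne'
    have hmm : poch c j = poch c m * poch (c + m) (j - m) := by
      rw [← poch_add, Nat.add_sub_cancel' hmj]
    have hq : poch (c + m) (j - m) ≠ 0 := (poch_pos_s16 (by positivity) _).ne'
    have h1 : (k.factorial : ℝ) = (k - m).factorial * k.descFactorial m := by
      exact_mod_cast (Nat.factorial_mul_descFactorial hmk).symm
    have h2 : (j.factorial : ℝ) = j.choose m * m.factorial * (j - m).factorial := by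
      exact_mod_cast (Nat.choose_mul_factorial_mul_factorial hmj).symm
    have h3 : (k.descFactorial m : ℝ) ≠ 0 := by
      exact_mod_cast (Nat.descFactorial_pos.2 hmk).ne'
    have h4 : (j.choose m : ℝ) ≠ 0 := by exact_mod_cast (Nat.choose_pos hmj).ne'
    rw [hmm, h1, h2]
    field_simp
  · intro m hm hm'
    have : k < m := by simp at hm hm'; omega
    simp [Nat.descFactorial_of_lt this]

lemma symm_moment_odd (β : ℝ) (m : ℕ) :
    ∫ u in (0 : ℝ)..1, (2 * u - 1) ^ (2 * m + 1) * (u ^ (β - 1) * (1 - u) ^ (β - 1)) = 0 := by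
  have h := intervalIntegral.integral_comp_sub_left (a := 0) (b := 1)
    (fun u : ℝ => (2 * u - 1) ^ (2 * m + 1) * (u ^ (β - 1) * (1 - u) ^ (β - 1))) 1
  have h2 : ∀ u : ℝ, (2 * (1 - u) - 1) ^ (2 * m + 1) *
      ((1 - u) ^ (β - 1) * (1 - (1 - u)) ^ (β - 1)) =
      -((2 * u - 1) ^ (2 * m + 1) * (u ^ (β - 1) * (1 - u) ^ (β - 1))) := by
    intro u
    have : 2 * (1 - u) - 1 = -(2 * u - 1) := by ring
    rw [this, (odd_two_mul_add_one m).neg_pow, sub_sub_cancel]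
    ring
  simp only [h2, intervalIntegral.integral_neg, sub_self, sub_zero] at h
  linarith

lemma symm_moment_integrable {β : ℝ} (hβ : 0 < β) (j : ℕ) : IntervalIntegrable
    (fun u : ℝ => (2 * u - 1) ^ j * (u ^ (β - 1) * (1 - u) ^ (β - 1))) volume 0 1 :=
  (intervalIntegrable_beta_integrand hβ hβ).continuousOn_mul (by fun_prop)

lemma symm_moment_recurrence {β : ℝ} (hβ : 0 < β) (j : ℕ) :
    (j + 1 + 2 * β) *
        ∫ u in (0 : ℝ)..1, (2 * u - 1) ^ (j + 2) * (u ^ (β - 1) * (1 - u) ^ (β - 1)) =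
      (j + 1) * ∫ u in (0 : ℝ)..1, (2 * u - 1) ^ j * (u ^ (β - 1) * (1 - u) ^ (β - 1)) := by
  rw [← sub_eq_zero, ← intervalIntegral.integral_const_mul, ← intervalIntegral.integral_const_mul,
    ← intervalIntegral.integral_sub ((symm_moment_integrable hβ _).const_mul _)
      ((symm_moment_integrable hβ _).const_mul _)]
  have h := intervalIntegral.integral_eq_sub_of_hasDerivAt_of_le (a := 0) (b := 1) zero_le_one
    (f := fun u : ℝ => -2 * ((2 * u - 1) ^ (j + 1) * (u ^ β * (1 - u) ^ β))) ?_ ?_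
    (((symm_moment_integrable hβ (j + 2)).const_mul (j + 1 + 2 * β)).sub
      ((symm_moment_integrable hβ j).const_mul (j + 1)))
  · rw [h]
    simp [Real.zero_rpow hβ.ne']
  · have h1 : Continuous fun u : ℝ => u ^ β := Real.continuous_rpow_const hβ.le
    have h2 : Continuous fun u : ℝ => (1 - u) ^ β := h1.comp (by fun_prop)
    fun_prop
  · intro u hu
    have hu1 : 0 < 1 - u := sub_pos.2 hu.2
    have d1 : HasDerivAt (fun u : ℝ => (2 * u - 1) ^ (j + 1))
        ((j + 1 : ℕ) * (2 * u - 1) ^ j * 2) u := by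
      simpa using (((hasDerivAt_id' u).const_mul 2).sub_const 1).fun_pow (j + 1)
    have d2 : HasDerivAt (fun u : ℝ => u ^ β) (β * u ^ (β - 1)) u :=
      Real.hasDerivAt_rpow_const (Or.inl hu.1.ne')
    have d3 : HasDerivAt (fun u : ℝ => (1 - u) ^ β) (-1 * β * (1 - u) ^ (β - 1)) u := by
      simpa using ((hasDerivAt_id u).const_sub 1).rpow_const (p := β) (Or.inl hu1.ne')
    refine ((d1.mul (d2.mul d3)).const_mul (-2)).congr_deriv ?_
    have e1 : u ^ β = u ^ (β - 1) * u := by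
      rw [← Real.rpow_add_one hu.1.ne', sub_add_cancel]
    have e2 : (1 - u) ^ β = (1 - u) ^ (β - 1) * (1 - u) := by
      rw [← Real.rpow_add_one hu1.ne', sub_add_cancel]
    simp only [Pi.mul_apply, e1, e2]
    push_cast
    ring

lemma symm_moment_even {β : ℝ} (hβ : 0 < β) (m : ℕ) :
    4 ^ m * m.factorial * poch (β + 1 / 2) m *
      ∫ u in (0 : ℝ)..1, (2 * u - 1) ^ (2 * m) * (u ^ (β - 1) * (1 - u) ^ (β - 1)) =
      (2 * m).factorial * betaFn β β := by
  induction m with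
  | zero => simp [poch_zero, betaFn]
  | succ m ih =>
    have h := symm_moment_recurrence hβ (2 * m)
    have e : 2 * (m + 1) = 2 * m + 1 + 1 := by ring
    rw [poch_succ, Nat.factorial_succ m, e, Nat.factorial_succ (2 * m + 1),
      Nat.factorial_succ (2 * m)]
    push_cast at h ⊢
    linear_combination (2 * m + 1 + 1) * (2 * m + 1) * ih +
      2 * (m + 1) * 4 ^ m * m.factorial * poch (β + 1 / 2) m * h

lemma sum_range_eq_sum_even {g : ℕ → ℝ} (hg : ∀ m, g (2 * m + 1) = 0) (n : ℕ) :
    ∑ j ∈ range (n + 1), g j = ∑ m ∈ range (n / 2 + 1), g (2 * m) := by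
  symm
  refine Finset.sum_of_injOn (fun m => 2 * m) (fun a _ b _ h => by simpa using h)
    (fun m hm => by simp at hm ⊢; omega) (fun j hj hj' => ?_) (fun _ _ => rfl)
  obtain ⟨m, rfl | rfl⟩ := Nat.even_or_odd' j
  · exact absurd ⟨m, by simp at hj ⊢; omega, rfl⟩ hj'
  · exact hg m

lemma integral_add_mul_pow_symm {β : ℝ} (hβ : 0 < β) (r s : ℝ) (n : ℕ) :
    ∫ u in (0 : ℝ)..1, (s + 2 * r * (2 * u - 1)) ^ n * (u ^ (β - 1) * (1 - u) ^ (β - 1)) =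
      betaFn β β * ∑ m ∈ range (n / 2 + 1),
        n.factorial / (m.factorial * (n - 2 * m).factorial * poch (β + 1 / 2) m) *
          ((r ^ 2) ^ m * s ^ (n - 2 * m)) := by
  have h1 : ∀ u : ℝ, (s + 2 * r * (2 * u - 1)) ^ n * (u ^ (β - 1) * (1 - u) ^ (β - 1)) =
      ∑ j ∈ range (n + 1), (2 * r) ^ j * s ^ (n - j) * n.choose j *
        ((2 * u - 1) ^ j * (u ^ (β - 1) * (1 - u) ^ (β - 1))) := by
    intro u
    rw [add_comm s, add_pow, Finset.sum_mul]
    refine Finset.sum_congr rfl fun j _ => ?_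
    rw [mul_pow]
    ring
  simp only [h1]
  rw [intervalIntegral.integral_finsetSum
    fun j _ => (symm_moment_integrable hβ j).const_mul _]
  simp only [intervalIntegral.integral_const_mul]
  rw [sum_range_eq_sum_even (fun m => by rw [symm_moment_odd, mul_zero]), Finset.mul_sum]
  refine Finset.sum_congr rfl fun m hm => ?_
  have hmn : 2 * m ≤ n := by simp at hm; omega
  have h2 : (n.factorial : ℝ) = n.choose (2 * m) * (2 * m).factorial * (n - 2 * m).factorial := by
    exact_mod_cast (Nat.choose_mul_factorial_mul_factorial hmn).symm
  have h3 := symm_moment_even hβ m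
  have h4 := (poch_pos_s16 (show 0 < β + 1 / 2 by linarith) m).ne'
  have h5 : (2 * r) ^ (2 * m) = 4 ^ m * (r ^ 2) ^ m := by
    rw [pow_mul, mul_pow, mul_pow]; norm_num
  rw [h2, h5]
  generalize poch (β + 1 / 2) m = P at h3 h4 ⊢
  generalize ∫ u in (0 : ℝ)..1, (2 * u - 1) ^ (2 * m) *
    (u ^ (β - 1) * (1 - u) ^ (β - 1)) = M at h3 ⊢
  field_simp
  linear_combination (r ^ 2) ^ m * s ^ (n - 2 * m) * n.choose (2 * m) * h3

lemma sum_mul_add_pow_eq {c : ℝ} (hc : 0 < c) (p q : ℝ) (n : ℕ) :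
    ∑ m ∈ range (n / 2 + 1),
        n.factorial / (m.factorial * (n - 2 * m).factorial * poch c m) *
          ((p * q) ^ m * (p + q) ^ (n - 2 * m)) =
      ∑ k ∈ range (n + 1),
        n.choose k * (p ^ k * q ^ (n - k)) * (poch c n / (poch c k * poch c (n - k))) := by
  have hL : ∀ m ∈ range (n / 2 + 1),
      n.factorial / (m.factorial * (n - 2 * m).factorial * poch c m) *
          ((p * q) ^ m * (p + q) ^ (n - 2 * m)) =
        ∑ i ∈ range (n - 2 * m + 1), n.factorial * (p ^ (m + i) * q ^ (n - (m + i))) *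
          (1 / ((m.factorial : ℝ) * i.factorial * (n - 2 * m - i).factorial * poch c m)) := by
    intro m hm
    rw [add_pow, Finset.mul_sum, Finset.mul_sum]
    refine Finset.sum_congr rfl fun i hi => ?_
    have hin : i ≤ n - 2 * m := by simp at hi; omega
    have hmn : 2 * m ≤ n := by simp at hm; omega
    have h2 : ((n - 2 * m).factorial : ℝ) =
        (n - 2 * m).choose i * i.factorial * (n - 2 * m - i).factorial := by
      exact_mod_cast (Nat.choose_mul_factorial_mul_factorial hin).symm
    have h4 := (poch_pos_s16 hc m).ne'
    have h5 : ((n - 2 * m).choose i : ℝ) ≠ 0 := by exact_mod_cast (Nat.choose_pos hin).ne'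
    have h6 : n - (m + i) = m + (n - 2 * m - i) := by omega
    rw [h2, h6]
    field_simp
    ring
  have hR : ∀ k ∈ range (n + 1),
      n.choose k * (p ^ k * q ^ (n - k)) * (poch c n / (poch c k * poch c (n - k))) =
        ∑ m ∈ range (min k (n - k) + 1), n.factorial * (p ^ k * q ^ (n - k)) *
          (1 / ((m.factorial : ℝ) * (k - m).factorial * (n - k - m).factorial * poch c m)) := by
    intro k hk
    have hkn : k ≤ n := by simp at hk; omega
    have h2 : (n.factorial : ℝ) = n.choose k * k.factorial * (n - k).factorial := by
      exact_mod_cast (Nat.choose_mul_factorial_mul_factorial hkn).symm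
    have h3 := (poch_pos_s16 hc k).ne'
    have h4 := (poch_pos_s16 hc (n - k)).ne'
    rw [← Finset.mul_sum, sum_inv_factorial_mul_poch hc, Nat.add_sub_cancel' hkn, h2]
    field_simp
  rw [Finset.sum_congr rfl hL, Finset.sum_congr rfl hR, Finset.sum_sigma', Finset.sum_sigma']
  refine Finset.sum_nbij' (fun a => ⟨a.1 + a.2, a.1⟩) (fun b => ⟨b.2, b.1 - b.2⟩) ?_ ?_ ?_ ?_ ?_
  · rintro ⟨m, i⟩ h
    simp at h ⊢
    omega
  · rintro ⟨k, m⟩ h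
    simp at h ⊢
    omega
  · rintro ⟨m, i⟩ h
    simp
  · rintro ⟨k, m⟩ h
    simp at h ⊢
    omega
  · rintro ⟨m, i⟩ h
    have : n - (m + i) - m = n - 2 * m - i := by omega
    rw [this, Nat.add_sub_cancel_left]

lemma integral_thetaFn_pow {α : ℝ} (hα : -(1 / 2 : ℝ) < α) (n : ℕ) {x t : ℝ} (hx : x ∈ I01)
    (ht : t ∈ I01) :
    ∫ u in (0 : ℝ)..1, thetaFn x t u ^ n * wght (α - 1 / 2) u =
      ∑ k ∈ range (n + 1), n.choose k * ((x * t) ^ k * ((1 - x) * (1 - t)) ^ (n - k)) *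
        (poch (α + 1) n / (poch (α + 1) k * poch (α + 1) (n - k))) := by
  have hp : 0 ≤ x * t := mul_nonneg hx.1 ht.1
  have hq : 0 ≤ (1 - x) * (1 - t) := mul_nonneg (sub_nonneg.2 hx.2) (sub_nonneg.2 ht.2)
  have hβ : 0 < α + 1 / 2 := by linarith
  have hB := (betaFn_pos hβ hβ).ne'
  have e1 : α - 1 / 2 + 1 = α + 1 / 2 := by ring
  have e2 : α - 1 / 2 = α + 1 / 2 - 1 := by ring
  have e3 : α + 1 / 2 + 1 / 2 = α + 1 := by ring
  rw [← sum_mul_add_pow_eq (by linarith : 0 < α + 1)]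
  have h := integral_add_mul_pow_symm hβ (√(x * t) * √((1 - x) * (1 - t)))
    (x * t + (1 - x) * (1 - t)) n
  rw [mul_pow, Real.sq_sqrt hp, Real.sq_sqrt hq, e3, mul_comm (betaFn _ _), ← div_eq_iff hB,
    ← intervalIntegral.integral_div] at h
  rw [← h]
  refine intervalIntegral.integral_congr fun u _ => ?_
  have h3 : thetaFn x t u = x * t + (1 - x) * (1 - t) +
      2 * (√(x * t) * √((1 - x) * (1 - t))) * (2 * u - 1) := by
    rw [thetaFn, aFn, bFn]
    linear_combination Real.sq_sqrt hp + Real.sq_sqrt hq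
  simp only [h3, wght, e1, ← e2]
  ring

theorem statement16 (α : ℝ) (hα : -(1 / 2 : ℝ) < α) (n : ℕ) (f : ℝ → ℝ)
    (hf : ContinuousOn f I01) (x : ℝ) (hx : x ∈ I01) :
    Dlup α n f x = poch (2 * α + 2) n / poch (α + 1) n *
      ∫ t in (0 : ℝ)..1,
        f t * (∫ u in (0 : ℝ)..1, thetaFn x t u ^ n * wght (α - 1 / 2) u) * wght α t := by
  have hα1 : -1 < α := by linarith
  have hc : 0 < α + 1 := by linarith
  have hbf : ∀ k, IntervalIntegrable (fun t => bern n k t * f t * wght α t) volume 0 1 := by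
    intro k
    refine (intervalIntegrable_wght hα1).continuousOn_mul ?_
    rw [Set.uIcc_of_le zero_le_one]
    have hb : Continuous (bern n k) := by unfold bern; fun_prop
    exact hb.continuousOn.mul hf
  have hD : Dlup α n f x = ∑ k ∈ Finset.range (n + 1), ∫ t in (0 : ℝ)..1,
      bern n k x / ip α (bern n k) (fun _ => 1) * (bern n k t * f t * wght α t) := by
    refine Finset.sum_congr rfl fun k _ => ?_
    rw [intervalIntegral.integral_const_mul, ip]
    ring
  rw [hD, ← intervalIntegral.integral_finsetSum fun k _ => (hbf k).const_mul _,
    ← intervalIntegral.integral_const_mul]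
  refine intervalIntegral.integral_congr fun t ht => ?_
  rw [Set.uIcc_of_le zero_le_one] at ht
  simp only [integral_thetaFn_pow hα n hx ht]
  rw [Finset.mul_sum, Finset.sum_mul, Finset.mul_sum]
  refine Finset.sum_congr rfl fun k hk => ?_
  have hkn : k ≤ n := by simp at hk; omega
  have h1 := (poch_pos_s16 hc n).ne'
  have h2 := (poch_pos_s16 hc k).ne'
  have h3 := (poch_pos_s16 hc (n - k)).ne'
  have h4 := (poch_pos_s16 (show 0 < 2 * α + 2 by linarith) n).ne'
  have h5 : (n.choose k : ℝ) ≠ 0 := by exact_mod_cast (Nat.choose_pos hkn).ne'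
  rw [ip_bern_one hα1 hkn, bern, bern, mul_pow, mul_pow]
  field_simp
end
end

section
/- Let α > −1, n ∈ ℕ, ν ∈ ℕ with ν ≤ n, and let f ∈ C^ν[0,1]. Then (d^ν/dx^ν) D_n^{⟨α⟩}(f,x) = (n! / ((n−ν)! (n+2α+2)_ν)) · D_{n−ν}^{⟨α+ν⟩}(f^{(ν)}, x) for all x ∈ [0,1]. -/
noncomputable section

open Set Finset
open scoped Classical

/-- The unnormalized Jacobi-weighted integral `∫₀¹ t^a (1-t)^b g(t) dt`. -/
def jacobiIntegral (a b : ℝ) (g : ℝ → ℝ) : ℝ :=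
  ∫ t in (0 : ℝ)..1, t ^ a * (1 - t) ^ b * g t

theorem intervalIntegrable_rpow_mul_one_sub_rpow {a b : ℝ} (ha : -1 < a) (hb : -1 < b) :
    IntervalIntegrable (fun t : ℝ => t ^ a * (1 - t) ^ b) MeasureTheory.volume 0 1 := by
  have h := Complex.betaIntegral_convergent (u := ((a + 1 : ℝ) : ℂ)) (v := ((b + 1 : ℝ) : ℂ))
    (by rw [Complex.ofReal_re]; linarith) (by rw [Complex.ofReal_re]; linarith)
  refine h.norm.congr_uIoo fun t ht => ?_
  rw [uIoo_of_le zero_le_one] at ht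
  have h1 : (1 - (t : ℂ)) = ((1 - t : ℝ) : ℂ) := by push_cast; rfl
  beta_reduce
  rw [norm_mul, h1, Complex.norm_cpow_eq_rpow_re_of_pos ht.1,
    Complex.norm_cpow_eq_rpow_re_of_pos (sub_pos.2 ht.2)]
  simp

theorem intervalIntegrable_jacobi {a b : ℝ} (ha : -1 < a) (hb : -1 < b) {g : ℝ → ℝ}
    (hg : ContinuousOn g I01) :
    IntervalIntegrable (fun t : ℝ => t ^ a * (1 - t) ^ b * g t) MeasureTheory.volume 0 1 :=
  (intervalIntegrable_rpow_mul_one_sub_rpow ha hb).mul_continuousOn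
    (by rwa [Set.uIcc_of_le zero_le_one])

theorem jacobiIntegral_one_pos {a b : ℝ} (ha : -1 < a) (hb : -1 < b) :
    0 < jacobiIntegral a b fun _ => 1 := by
  refine intervalIntegral.intervalIntegral_pos_of_pos_on
    (intervalIntegrable_jacobi ha hb continuousOn_const) (fun t ht => ?_) zero_lt_one
  have := Real.rpow_pos_of_pos ht.1 a
  have := Real.rpow_pos_of_pos (sub_pos.2 ht.2) b
  positivity

theorem betaFn_eq_jacobiIntegral (x y : ℝ) :
    betaFn x y = jacobiIntegral (x - 1) (y - 1) fun _ => 1 := by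
  simp [betaFn, jacobiIntegral]

/-- Integration by parts against a Jacobi weight with positive exponents. -/
theorem jacobiIntegral_deriv {a b : ℝ} (ha : 0 < a) (hb : 0 < b) {g g' : ℝ → ℝ}
    (hg : ContinuousOn g I01) (hg' : ContinuousOn g' I01)
    (hd : ∀ t ∈ Ioo (0 : ℝ) 1, HasDerivAt g (g' t) t) :
    jacobiIntegral a b g' = b * jacobiIntegral a (b - 1) g - a * jacobiIntegral (a - 1) b g := by
  have i0 := intervalIntegrable_jacobi (a := a) (b := b) (by linarith) (by linarith) hg'
  have i1 := intervalIntegrable_jacobi (a := a) (b := b - 1) (by linarith) (by linarith) hg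
  have i2 := intervalIntegrable_jacobi (a := a - 1) (b := b) (by linarith) (by linarith) hg
  have hc : ContinuousOn (fun t : ℝ => t ^ a * (1 - t) ^ b * g t) (Icc 0 1) := by
    refine ContinuousOn.mul (Continuous.continuousOn ?_) hg
    exact (Real.continuous_rpow_const ha.le).mul
      ((Real.continuous_rpow_const hb.le).comp (continuous_const.sub continuous_id))
  have key := intervalIntegral.integral_eq_sub_of_hasDerivAt_of_le zero_le_one hc
    (f' := fun t => t ^ a * (1 - t) ^ b * g' t - b * (t ^ a * (1 - t) ^ (b - 1) * g t)
      + a * (t ^ (a - 1) * (1 - t) ^ b * g t)) (fun t ht => ?_)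
    ((i0.sub (i1.const_mul b)).add (i2.const_mul a))
  · rw [intervalIntegral.integral_add (i0.sub (i1.const_mul b)) (i2.const_mul a),
      intervalIntegral.integral_sub i0 (i1.const_mul b), intervalIntegral.integral_const_mul,
      intervalIntegral.integral_const_mul] at key
    simp only [sub_self, Real.zero_rpow ha.ne', Real.zero_rpow hb.ne', zero_mul, mul_zero] at key
    unfold jacobiIntegral
    linarith
  · have h1 : HasDerivAt (fun t : ℝ => t ^ a) (a * t ^ (a - 1)) t :=
      Real.hasDerivAt_rpow_const (Or.inl ht.1.ne')
    have h2 : HasDerivAt (fun t : ℝ => (1 - t) ^ b) (-1 * b * (1 - t) ^ (b - 1)) t :=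
      ((hasDerivAt_id t).const_sub 1).rpow_const (Or.inl (sub_pos.2 ht.2).ne')
    refine ((h1.mul h2).mul (hd t ht)).congr_deriv ?_
    simp only [Pi.mul_apply]
    ring

theorem mul_jacobiIntegral_one_symm {a b : ℝ} (ha : 0 < a) (hb : 0 < b) :
    b * jacobiIntegral a (b - 1) (fun _ => 1) = a * jacobiIntegral (a - 1) b fun _ => 1 := by
  have h := jacobiIntegral_deriv ha hb (g := fun _ => 1) (g' := fun _ => 0) continuousOn_const
    continuousOn_const fun t _ => hasDerivAt_const t 1
  have h0 : jacobiIntegral a b (fun _ => 0) = 0 := by simp [jacobiIntegral]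
  linarith

theorem jacobiIntegral_one_recurrence {a b : ℝ} (ha : 0 < a) (hb : 0 < b) :
    (a + b + 1) * jacobiIntegral a b (fun _ => 1) =
      b * jacobiIntegral a (b - 1) fun _ => 1 := by
  have h := jacobiIntegral_deriv ha hb (g := fun t => t) (g' := fun _ => 1) continuousOn_id
    continuousOn_const fun t _ => hasDerivAt_id t
  have h1 : jacobiIntegral (a - 1) b (fun t => t) = jacobiIntegral a b fun _ => 1 := by
    refine intervalIntegral.integral_congr_Ioo_of_le zero_le_one fun t ht => ?_
    have : t ^ a = t ^ (a - 1) * t := by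
      rw [← Real.rpow_add_one ht.1.ne', sub_add_cancel]
    simp only [this]
    ring
  have h2 : jacobiIntegral a (b - 1) (fun t => t) =
      jacobiIntegral a (b - 1) (fun _ => 1) - jacobiIntegral a b fun _ => 1 := by
    unfold jacobiIntegral
    rw [← intervalIntegral.integral_sub
      (intervalIntegrable_jacobi (by linarith) (by linarith) continuousOn_const)
      (intervalIntegrable_jacobi (by linarith) (by linarith) continuousOn_const)]
    refine intervalIntegral.integral_congr_Ioo_of_le zero_le_one fun t ht => ?_
    have : (1 - t) ^ b = (1 - t) ^ (b - 1) * (1 - t) := by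
      rw [← Real.rpow_add_one (sub_pos.2 ht.2).ne', sub_add_cancel]
    simp only [this]
    ring
  rw [h1, h2] at h
  linarith

/-- The difference of two adjacent normalized Jacobi means of `g` is a mean of its derivative. -/
theorem jacobiIntegral_div_sub_div {a b : ℝ} (ha : 0 < a) (hb : 0 < b) {g g' : ℝ → ℝ}
    (hg : ContinuousOn g I01) (hg' : ContinuousOn g' I01)
    (hd : ∀ t ∈ Ioo (0 : ℝ) 1, HasDerivAt g (g' t) t) :
    jacobiIntegral a (b - 1) g / jacobiIntegral a (b - 1) (fun _ => 1) -
        jacobiIntegral (a - 1) b g / jacobiIntegral (a - 1) b (fun _ => 1) =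
      jacobiIntegral a b g' / jacobiIntegral a b (fun _ => 1) / (a + b + 1) := by
  have h1 := jacobiIntegral_one_recurrence ha hb
  have h2 := mul_jacobiIntegral_one_symm ha hb
  have h3 : 0 < jacobiIntegral a b fun _ => 1 :=
    jacobiIntegral_one_pos (by linarith) (by linarith)
  have hs : 0 < a + b + 1 := by linarith
  rw [h2] at h1
  have e2 : jacobiIntegral (a - 1) b (fun _ => 1) =
      (a + b + 1) * jacobiIntegral a b (fun _ => 1) / a := by
    rw [h1]; field_simp
  have e1 : jacobiIntegral a (b - 1) (fun _ => 1) =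
      (a + b + 1) * jacobiIntegral a b (fun _ => 1) / b := by
    rw [h1, ← h2]; field_simp
  rw [e1, e2, jacobiIntegral_deriv ha hb hg hg' hd]
  field_simp

theorem ip_bern (α : ℝ) (n k : ℕ) (g : ℝ → ℝ) :
    ip α (bern n k) g = (n.choose k : ℝ) / betaFn (α + 1) (α + 1) *
      jacobiIntegral (k + α) (((n - k : ℕ) : ℝ) + α) g := by
  unfold ip jacobiIntegral
  rw [← intervalIntegral.integral_const_mul]
  refine intervalIntegral.integral_congr_Ioo_of_le zero_le_one fun t ht => ?_
  simp only [bern, wght, Real.rpow_add ht.1, Real.rpow_add (sub_pos.2 ht.2), Real.rpow_natCast]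
  ring

theorem ip_bern_div {α : ℝ} (hα : -1 < α) {n k : ℕ} (hk : k ≤ n) (g : ℝ → ℝ) :
    ip α (bern n k) g / ip α (bern n k) (fun _ => 1) =
      jacobiIntegral (k + α) (((n - k : ℕ) : ℝ) + α) g /
        jacobiIntegral (k + α) (((n - k : ℕ) : ℝ) + α) fun _ => 1 := by
  rw [ip_bern, ip_bern]
  refine mul_div_mul_left _ _ (div_pos (by exact_mod_cast Nat.choose_pos hk) ?_).ne'
  rw [betaFn_eq_jacobiIntegral]
  exact jacobiIntegral_one_pos (by linarith) (by linarith)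

theorem bern_eq_eval (n k : ℕ) : bern n k = fun x => (bernsteinPolynomial ℝ n k).eval x := by
  ext x
  simp [bern, bernsteinPolynomial]

theorem hasDerivAt_sum_bern (m : ℕ) (c : ℕ → ℝ) (x : ℝ) :
    HasDerivAt (fun y => ∑ k ∈ Finset.range (m + 2), bern (m + 1) k y * c k)
      ((m + 1) * ∑ k ∈ Finset.range (m + 1), bern m k x * (c (k + 1) - c k)) x := by
  have hk (k : ℕ) : HasDerivAt (bern (m + 1) k)
      ((bernsteinPolynomial ℝ (m + 1) k).derivative.eval x) x := by
    rw [bern_eq_eval]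
    exact Polynomial.hasDerivAt _ _
  refine (HasDerivAt.fun_sum fun k (_ : k ∈ Finset.range (m + 2)) =>
    (hk k).mul_const (c k)).congr_deriv ?_
  have htop : bern m (m + 1) x = 0 := by simp [bern]
  have e1 : ∑ k ∈ Finset.range (m + 1), bern m (k + 1) x * c (k + 1) + bern m 0 x * c 0 =
      ∑ k ∈ Finset.range (m + 1), bern m k x * c k := by
    rw [← Finset.sum_range_succ' (fun k => bern m k x * c k), Finset.sum_range_succ, htop]
    simp
  rw [Finset.sum_range_succ']
  simp only [bernsteinPolynomial.derivative_succ, bernsteinPolynomial.derivative_zero,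
    Nat.add_sub_cancel, Polynomial.eval_mul, Polynomial.eval_sub, Polynomial.eval_neg,
    Polynomial.eval_natCast]
  simp only [← congrFun (bern_eq_eval _ _) x, mul_sub, Finset.sum_sub_distrib, sub_mul, ← e1,
    mul_assoc, ← Finset.mul_sum]
  push_cast
  ring

theorem deriv_Dlup {α : ℝ} (hα : -1 < α) (m : ℕ) {f f' : ℝ → ℝ}
    (hf : ContinuousOn f I01) (hf' : ContinuousOn f' I01)
    (hd : ∀ t ∈ Ioo (0 : ℝ) 1, HasDerivAt f (f' t) t) :
    deriv (Dlup α (m + 1) f) =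
      fun x => ((m : ℝ) + 1) / (m + 1 + 2 * α + 2) * Dlup (α + 1) m f' x := by
  ext x
  refine (hasDerivAt_sum_bern m _ x).deriv.trans ?_
  rw [div_mul_eq_mul_div, mul_div_assoc]
  congr 1
  rw [Dlup, Finset.sum_div]
  refine Finset.sum_congr rfl fun k hk => ?_
  have hkm : k ≤ m := Nat.lt_succ_iff.1 (Finset.mem_range.1 hk)
  rw [mul_div_assoc]
  congr 1
  rw [ip_bern_div hα (Nat.add_le_add_right hkm 1),
    ip_bern_div hα (Nat.le_succ_of_le hkm),
    ip_bern_div (by linarith) hkm]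
  have hb : ((m - k : ℕ) : ℝ) = m - k := Nat.cast_sub hkm
  have hb' : ((m + 1 - k : ℕ) : ℝ) = m + 1 - k := by
    rw [Nat.cast_sub (hkm.trans m.le_succ)]; push_cast; rfl
  have hkm' : (k : ℝ) ≤ m := by exact_mod_cast hkm
  have hk0 : (0 : ℝ) ≤ k := k.cast_nonneg
  have h := jacobiIntegral_div_sub_div (a := k + (α + 1)) (b := (m - k : ℝ) + (α + 1))
    (by linarith) (by linarith) hf hf' hd
  rw [Nat.add_sub_add_right, hb, hb']
  push_cast
  convert h using 2 <;> ring_nf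

theorem iteratedDeriv_Dlup (ν : ℕ) : ∀ (α : ℝ) (_ : -1 < α) (n : ℕ) (_ : ν ≤ n) (f : ℝ → ℝ)
    (_ : ContDiffOn ℝ ν f I01) (x : ℝ),
      iteratedDeriv ν (Dlup α n f) x =
        (n.factorial : ℝ) / (((n - ν).factorial : ℝ) * poch ((n : ℝ) + 2 * α + 2) ν) *
          Dlup (α + ν) (n - ν) (iteratedDerivWithin ν f I01) x := by
  induction ν with
  | zero =>
    intro α _ n _ f _ x
    have : (n.factorial : ℝ) ≠ 0 := by positivity
    simp [poch, this]
  | succ ν ih =>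
    intro α hα n hn f hf x
    obtain ⟨m, rfl⟩ : ∃ m, n = m + 1 := ⟨n - 1, by omega⟩
    have hu : UniqueDiffOn ℝ I01 := uniqueDiffOn_Icc zero_lt_one
    obtain ⟨hdiff, -, hC⟩ := (contDiffOn_succ_iff_derivWithin (n := (ν : WithTop ℕ∞)) hu).1
      (by exact_mod_cast hf)
    rw [iteratedDeriv_succ', iteratedDerivWithin_succ', deriv_Dlup hα m hdiff.continuousOn
        hC.continuousOn fun t ht => (hdiff t (Ioo_subset_Icc_self ht)).hasDerivWithinAt.hasDerivAt
          (Icc_mem_nhds ht.1 ht.2),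
      iteratedDeriv_const_mul_field, ih (α + 1) (by linarith) m (by omega) _ hC x,
      Nat.add_sub_add_right, Nat.factorial_succ]
    have hp : poch (((m + 1 : ℕ) : ℝ) + 2 * α + 2) (ν + 1) =
        (m + 1 + 2 * α + 2) * poch ((m : ℝ) + 2 * (α + 1) + 2) ν := by
      simp only [poch, ascPochhammer_succ_left, Polynomial.eval_mul, Polynomial.eval_X,
        Polynomial.eval_comp, Polynomial.eval_add, Polynomial.eval_one]
      push_cast
      ring_nf
    have hα' : α + 1 + (ν : ℝ) = α + ((ν + 1 : ℕ) : ℝ) := by push_cast; ring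
    rw [hp, hα', ← mul_assoc, div_mul_div_comm]
    push_cast
    congr 2
    ring

theorem statement18 (α : ℝ) (hα : -1 < α) (n ν : ℕ) (hν : 1 ≤ ν) (hνn : ν ≤ n)
    (f : ℝ → ℝ) (hf : ContDiffOn ℝ (ν : ℕ∞) f I01) :
    ∀ x ∈ I01,
      iteratedDeriv ν (Dlup α n f) x =
        (n.factorial : ℝ) / (((n - ν).factorial : ℝ) * poch ((n : ℝ) + 2 * α + 2) ν) *
          Dlup (α + ν) (n - ν) (iteratedDerivWithin ν f I01) x := by
  exact fun x _ => iteratedDeriv_Dlup ν α hα n hνn f (by exact_mod_cast hf) x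
end
end

section
/- Let α > −1 and n ≥ 2. Then the shifted normalized ultraspherical polynomials satisfy, for all z: φ_n^{(α)}(z) = (2z − 1) φ_{n−1}^{(α+1)}(z) − ((n−1)(2α+n+2) / ((α+1)(α+2))) · z(1−z) · φ_{n−2}^{(α+2)}(z). -/
noncomputable section

open Set Finset
open scoped Classical

/-- Differentiating `x(1-x) w' = β (1-2x) w` repeatedly gives a three-term recurrence between
consecutive derivatives of `w`. -/
theorem derivatives_three_term (g : ℕ → ℝ → ℝ) (β : ℝ)
    (hD : ∀ k, ∀ x ∈ Set.Ioo (0 : ℝ) 1, HasDerivAt (g k) (g (k + 1) x) x)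
    (hg : ∀ x ∈ Set.Ioo (0 : ℝ) 1, x * (1 - x) * g 1 x = β * (1 - 2 * x) * g 0 x) (k : ℕ) :
    ∀ x ∈ Set.Ioo (0 : ℝ) 1, x * (1 - x) * g (k + 2) x =
      (β - k - 1) * (1 - 2 * x) * g (k + 1) x - (k + 1) * (2 * β - k) * g k x := by
  have hu (x : ℝ) : HasDerivAt (fun y : ℝ => y * (1 - y)) (1 - 2 * x) x :=
    ((hasDerivAt_id' x).mul ((hasDerivAt_id' x).const_sub 1)).congr_deriv (by ring)
  have hl (c x : ℝ) : HasDerivAt (fun y : ℝ => c * (1 - 2 * y)) (-2 * c) x :=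
    ((((hasDerivAt_id' x).const_mul 2).const_sub 1).const_mul c).congr_deriv (by ring)
  induction k with
  | zero =>
    intro x hx
    have hev : (fun y : ℝ => y * (1 - y) * g 1 y) =ᶠ[nhds x]
        fun y => β * (1 - 2 * y) * g 0 y :=
      Filter.eventuallyEq_of_mem (isOpen_Ioo.mem_nhds hx) hg
    have h := ((hu x).mul (hD 1 x hx)).unique
      (((hl β x).mul (hD 0 x hx)).congr_of_eventuallyEq hev)
    norm_num at h ⊢
    linear_combination h
  | succ k ih =>
    intro x hx
    have hev : (fun y : ℝ => y * (1 - y) * g (k + 2) y) =ᶠ[nhds x]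
        fun y => (β - k - 1) * (1 - 2 * y) * g (k + 1) y - (k + 1) * (2 * β - k) * g k y :=
      Filter.eventuallyEq_of_mem (isOpen_Ioo.mem_nhds hx) ih
    have h := ((hu x).mul (hD (k + 2) x hx)).unique
      ((((hl (β - k - 1) x).mul (hD (k + 1) x hx)).sub
        ((hD k x hx).const_mul ((k + 1) * (2 * β - k)))).congr_of_eventuallyEq hev)
    push_cast
    linear_combination h

theorem analyticAt_rpow_mul_rpow (β : ℝ) {x : ℝ} (hx : x ∈ Set.Ioo (0 : ℝ) 1) :
    AnalyticAt ℝ (fun y : ℝ => y ^ β * (1 - y) ^ β) x :=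
  ContDiffAt.analyticAt <| (Real.contDiffAt_rpow_const_of_ne hx.1.ne').mul
    ((contDiffAt_const.sub contDiffAt_id).rpow_const_of_ne (sub_pos.2 hx.2).ne')

theorem deriv_rpow_mul_rpow (β : ℝ) {x : ℝ} (hx : x ∈ Set.Ioo (0 : ℝ) 1) :
    x * (1 - x) * deriv (fun y : ℝ => y ^ β * (1 - y) ^ β) x =
      β * (1 - 2 * x) * (x ^ β * (1 - x) ^ β) := by
  have h0 : x ≠ 0 := hx.1.ne'
  have h1 : 1 - x ≠ 0 := (sub_pos.2 hx.2).ne'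
  have h := ((hasDerivAt_id' x).rpow_const (p := β) (Or.inl h0)).mul
    (((hasDerivAt_id' x).const_sub 1).rpow_const (p := β) (Or.inl h1))
  have h' : deriv (fun y : ℝ => y ^ β * (1 - y) ^ β) x = _ := h.deriv
  rw [h', Real.rpow_sub_one h0, Real.rpow_sub_one h1]
  field_simp
  ring

theorem poch_succ_left (x : ℝ) (k : ℕ) : poch x (k + 1) = x * poch (x + 1) k := by
  simp [poch, ascPochhammer_succ_left, Polynomial.eval_comp]

theorem ultra_three_term (α : ℝ) (hα : -1 < α) (k : ℕ) {x : ℝ} (hx : x ∈ Set.Ioo (0 : ℝ) 1) :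
    ultra α (k + 2) x = (2 * x - 1) * ultra (α + 1) (k + 1) x -
      ((k : ℝ) + 1) * (2 * α + k + 4) / ((α + 1) * (α + 2)) * (x * (1 - x)) *
        ultra (α + 2) k x := by
  have h0 : x ≠ 0 := hx.1.ne'
  have h1 : 1 - x ≠ 0 := (sub_pos.2 hx.2).ne'
  have hrec := derivatives_three_term
    (fun j => iteratedDeriv j (fun y : ℝ => y ^ (k + 2 + α) * (1 - y) ^ (k + 2 + α))) (k + 2 + α)
    (fun j y hy => by
      have hd := ((analyticAt_rpow_mul_rpow (k + 2 + α) hy).iterated_deriv j).differentiableAt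
      rw [← iteratedDeriv_eq_iterate] at hd
      simpa only [iteratedDeriv_succ] using hd.hasDerivAt)
    (fun y hy => by
      simpa only [iteratedDeriv_one, iteratedDeriv_zero] using deriv_rpow_mul_rpow _ hy) k x hx
  have e1 : ((k + 1 : ℕ) : ℝ) + (α + 1) = k + 2 + α := by push_cast; ring
  have e2 : (k : ℝ) + (α + 2) = k + 2 + α := by ring
  have e0 : ((k + 2 : ℕ) : ℝ) + α = k + 2 + α := by push_cast; ring
  have hp : poch (α + 2 + 1) k ≠ 0 := (ascPochhammer_pos k _ (by linarith)).ne'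
  have ha1 : α + 1 ≠ 0 := by linarith
  have ha2 : α + 2 ≠ 0 := by linarith
  have r (y : ℝ) (hy : y ≠ 0) : y ^ (-α) = y * y * y ^ (-(α + 2)) ∧
      y ^ (-(α + 1)) = y * y ^ (-(α + 2)) := by
    have q (s : ℝ) : y * y ^ (s - 1) = y ^ s := by rw [Real.rpow_sub_one hy]; field_simp
    have q1 := q (-α)
    have q2 := q (-(α + 1))
    rw [show -α - 1 = -(α + 1) by ring] at q1
    rw [show -(α + 1) - 1 = -(α + 2) by ring] at q2
    exact ⟨by rw [mul_assoc, q2, q1], q2.symm⟩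
  unfold ultra
  rw [e0, e1, e2, poch_succ_left (α + 1), poch_succ_left (α + 1 + 1),
    show α + 1 + 1 = α + 2 by ring, (r x h0).1, (r x h0).2, (r _ h1).1, (r _ h1).2]
  generalize x ^ (-(α + 2)) = X
  generalize (1 - x) ^ (-(α + 2)) = Y
  generalize poch (α + 2 + 1) k = P at *
  generalize (fun y : ℝ => y ^ (k + 2 + α) * (1 - y) ^ (k + 2 + α)) = w at *
  generalize iteratedDeriv (k + 2) w x = D2 at *
  generalize iteratedDeriv (k + 1) w x = D1 at *
  generalize iteratedDeriv k w x = D0 at *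
  rw [show (-1 : ℝ) ^ (k + 2) = (-1) ^ k by ring, show (-1 : ℝ) ^ (k + 1) = -(-1) ^ k by ring]
  generalize (-1 : ℝ) ^ k = S
  field_simp
  linear_combination S * X * Y * hrec

theorem statement19 (α : ℝ) (hα : -1 < α) (n : ℕ) (hn : 2 ≤ n)
    (Φ Φ1 Φ2 : ℝ → ℝ)
    (h0 : ∃ p : Polynomial ℝ, p.natDegree ≤ n ∧ ∀ x, Φ x = p.eval x)
    (h0' : ∀ x ∈ Set.Ioo (0 : ℝ) 1, Φ x = ultra α n x)
    (h1 : ∃ p : Polynomial ℝ, p.natDegree ≤ n - 1 ∧ ∀ x, Φ1 x = p.eval x)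
    (h1' : ∀ x ∈ Set.Ioo (0 : ℝ) 1, Φ1 x = ultra (α + 1) (n - 1) x)
    (h2 : ∃ p : Polynomial ℝ, p.natDegree ≤ n - 2 ∧ ∀ x, Φ2 x = p.eval x)
    (h2' : ∀ x ∈ Set.Ioo (0 : ℝ) 1, Φ2 x = ultra (α + 2) (n - 2) x) :
    ∀ z : ℝ,
      Φ z = (2 * z - 1) * Φ1 z -
        ((n : ℝ) - 1) * (2 * α + (n : ℝ) + 2) / ((α + 1) * (α + 2)) *
          (z * (1 - z)) * Φ2 z := by
  obtain ⟨p, -, hp⟩ := h0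
  obtain ⟨p1, -, hp1⟩ := h1
  obtain ⟨p2, -, hp2⟩ := h2
  obtain ⟨k, rfl⟩ := Nat.exists_eq_add_of_le' hn
  set c : ℝ := (((k + 2 : ℕ) : ℝ) - 1) * (2 * α + ((k + 2 : ℕ) : ℝ) + 2) / ((α + 1) * (α + 2))
    with hc
  have key : p = (2 * Polynomial.X - 1) * p1 -
      Polynomial.C c * (Polynomial.X * (1 - Polynomial.X)) * p2 := by
    refine Polynomial.eq_of_infinite_eval_eq _ _ ((Set.Ioo_infinite zero_lt_one).mono
      fun x hx => ?_)
    have h : ultra α (k + 2) x = _ := ultra_three_term α hα k hx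
    have e1 : Φ1 x = ultra (α + 1) (k + 1) x := h1' x hx
    have e2 : Φ2 x = ultra (α + 2) k x := h2' x hx
    rw [← h0' x hx, ← e1, ← e2, hp, hp1, hp2] at h
    simp only [Set.mem_ofPred_eq, Polynomial.eval_sub, Polynomial.eval_mul, Polynomial.eval_X,
      Polynomial.eval_one, Polynomial.eval_C, Polynomial.eval_ofNat]
    rw [h, hc]
    push_cast
    ring
  intro z
  rw [hp, hp1, hp2, key]
  simp
end
end
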